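/- Let A and H be Lie bialgebras, let ◁ : H × A → H make H a right A-module Lie algebra (h ◁ [a,b] = (h ◁ a) ◁ b − (h ◁ b) ◁ a and [h,g] ◁ a = [h ◁ a, g] + [h, g ◁ a]), and let φ : A → H ⊗ A, φ(a) = a₍₋₁₎ ⊗ a₍₀₎, make A a left H-comodule Lie coalgebra ((δ_H ⊗ id)∘φ = (id ⊗ φ)∘φ − (τ ⊗ id)∘(id ⊗ φ)∘φ, and a₍₋₁₎ ⊗ a₍₀₎₁ ⊗ a₍₀₎₂ = a₁₍₋₁₎ ⊗ a₁₍₀₎ ⊗ a₂ + a₂₍₋₁₎ ⊗ a₁ ⊗ a₂₍₀₎). Assume (BB6): δ_H(h ◁ a) = h₁ ⊗ h₂ ◁ a + h₁ ◁ a ⊗ h₂ + a₍₋₁₎ ⊗ h ◁ a₍₀₎ − h ◁ a₍₀₎ ⊗ a₍₋₁₎; (BB7): φ([a,b]) = a₍₋₁₎ ⊗ [a₍₀₎, b] + b₍₋₁₎ ⊗ [a, b₍₀₎] + a₍₋₁₎ ◁ b ⊗ a₍₀₎ − b₍₋₁₎ ◁ a ⊗ b₍₀₎; and (AA3): [h,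 a₍₋₁₎] ⊗ a₍₀₎ + h ◁ a₁ ⊗ a₂ = 0 in H ⊗ A. Then A ⊕ H with the semidirect sum bracket [(a,h),(b,g)] = ([a,b], [h,g] + h ◁ b − g ◁ a) and the cobracket δ_D(a) = δ_A(a) + φ(a) − τφ(a), δ_D(h) = δ_H(h) is a Lie bialgebra (the right-left bicross product A ⊳◀ H). -/

import Mathlib

open TensorProduct

noncomputable section

variable {k : Type*} [Field k]
variable {A H : Type*} [AddCommGroup A] [Module k A] [AddCommGroup H] [Module k H]

/-- The cyclic rotation `ξ : u ⊗ v ⊗ w ↦ v ⊗ w ⊗ u` on `(L ⊗ L) ⊗ L`. -/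
def ξmap (k L : Type*) [Field k] [AddCommGroup L] [Module k L] :
    ((L ⊗[k] L) ⊗[k] L) →ₗ[k] ((L ⊗[k] L) ⊗[k] L) :=
  (TensorProduct.comm k L (L ⊗[k] L)).toLinearMap ∘ₗ (TensorProduct.assoc k L L L).toLinearMap

/-- Swap the last two tensor factors: `(m ⊗ n) ⊗ p ↦ (m ⊗ p) ⊗ n`. -/
def swapR (k M N P : Type*) [Field k] [AddCommGroup M] [Module k M] [AddCommGroup N]
    [Module k N] [AddCommGroup P] [Module k P] :
    ((M ⊗[k] N) ⊗[k] P) →ₗ[k] ((M ⊗[k] P) ⊗[k] N) :=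
  (TensorProduct.assoc k M P N).symm.toLinearMap
    ∘ₗ TensorProduct.map LinearMap.id (TensorProduct.comm k N P).toLinearMap
    ∘ₗ (TensorProduct.assoc k M N P).toLinearMap

/-- A bilinear bracket is a Lie algebra structure: antisymmetry and the Jacobi identity. -/
def IsLieAlg {L : Type*} [AddCommGroup L] [Module k L] (br : L →ₗ[k] L →ₗ[k] L) : Prop :=
  (∀ x y, br x y = - br y x) ∧
  (∀ x y z, br (br x y) z + br (br y z) x + br (br z x) y = 0)

/-- A cobracket is a Lie coalgebra structure: coanticommutativity `τ ∘ δ = −δ` and the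
co-Jacobi identity `(id + ξ + ξ²) ∘ (δ ⊗ id) ∘ δ = 0`. -/
def IsLieCoalg {L : Type*} [AddCommGroup L] [Module k L] (δ : L →ₗ[k] L ⊗[k] L) : Prop :=
  (∀ x, TensorProduct.comm k L L (δ x) = - δ x) ∧
  (∀ x, TensorProduct.map δ LinearMap.id (δ x)
      + ξmap k L (TensorProduct.map δ LinearMap.id (δ x))
      + ξmap k L (ξmap k L (TensorProduct.map δ LinearMap.id (δ x))) = 0)

/-- A Lie bialgebra: simultaneously a Lie algebra and a Lie coalgebra satisfying (LB):
`δ[x,y] = [x,y₁]⊗y₂ + y₁⊗[x,y₂] + x₁⊗[x₂,y] + [x₁,y]⊗x₂` (Sweedler notation). -/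
def IsLieBialg {L : Type*} [AddCommGroup L] [Module k L]
    (br : L →ₗ[k] L →ₗ[k] L) (δ : L →ₗ[k] L ⊗[k] L) : Prop :=
  IsLieAlg br ∧ IsLieCoalg δ ∧
  ∀ x y, δ (br x y)
      = TensorProduct.map (br x) LinearMap.id (δ y)
      + TensorProduct.map LinearMap.id (br x) (δ y)
      + TensorProduct.map LinearMap.id (br.flip y) (δ x)
      + TensorProduct.map (br.flip y) LinearMap.id (δ x)

/-- The bracket on the direct sum `A ⊕ H`:
`[(a,h),(b,g)] = ([a,b] + h▷b − g▷a + σ(h,g), [h,g] + h◁b − g◁a + θ(a,b))`. -/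
def bbBracket (brA : A →ₗ[k] A →ₗ[k] A) (brH : H →ₗ[k] H →ₗ[k] H)
    (r : H →ₗ[k] A →ₗ[k] A) (l : H →ₗ[k] A →ₗ[k] H)
    (σ : H →ₗ[k] H →ₗ[k] A) (θ : A →ₗ[k] A →ₗ[k] H) :
    (A × H) →ₗ[k] (A × H) →ₗ[k] (A × H) :=
  LinearMap.mk₂ k
    (fun x y => (brA x.1 y.1 + r x.2 y.1 - r y.2 x.1 + σ x.2 y.2,
                 brH x.2 y.2 + l x.2 y.1 - l y.2 x.1 + θ x.1 y.1))
    (fun x x' y => by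
      simp only [Prod.fst_add, Prod.snd_add, map_add, LinearMap.add_apply, Prod.mk_add_mk,
        Prod.mk.injEq]
      all_goals try (constructor <;> abel))
    (fun c x y => by
      simp only [Prod.smul_fst, Prod.smul_snd, map_smul, LinearMap.smul_apply, Prod.smul_mk,
        Prod.mk.injEq, smul_add, smul_sub]
      all_goals try (constructor <;> abel))
    (fun x y y' => by
      simp only [Prod.fst_add, Prod.snd_add, map_add, LinearMap.add_apply, Prod.mk_add_mk,
        Prod.mk.injEq]
      all_goals try (constructor <;> abel))
    (fun c x y => by
      simp only [Prod.smul_fst, Prod.smul_snd, map_smul, LinearMap.smul_apply, Prod.smul_mk,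
        Prod.mk.injEq, smul_add, smul_sub]
      all_goals try (constructor <;> abel))

/-- The cobracket on the direct sum `A ⊕ H`:
`δ_D(a) = δ_A(a) + φ(a) − τφ(a) + P(a)` and `δ_D(h) = δ_H(h) + ψ(h) − τψ(h) + Q(h)`,
all terms viewed inside `(A ⊕ H) ⊗ (A ⊕ H)`. -/
def bbCobracket (δA : A →ₗ[k] A ⊗[k] A) (δH : H →ₗ[k] H ⊗[k] H)
    (φ : A →ₗ[k] H ⊗[k] A) (ψ : H →ₗ[k] H ⊗[k] A)
    (P : A →ₗ[k] H ⊗[k] H) (Q : H →ₗ[k] A ⊗[k] A) :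
    (A × H) →ₗ[k] (A × H) ⊗[k] (A × H) :=
  (TensorProduct.map (LinearMap.inl k A H) (LinearMap.inl k A H) ∘ₗ δA
    + TensorProduct.map (LinearMap.inr k A H) (LinearMap.inl k A H) ∘ₗ φ
    - TensorProduct.map (LinearMap.inl k A H) (LinearMap.inr k A H)
        ∘ₗ (TensorProduct.comm k H A).toLinearMap ∘ₗ φ
    + TensorProduct.map (LinearMap.inr k A H) (LinearMap.inr k A H) ∘ₗ P) ∘ₗ LinearMap.fst k A H
  + (TensorProduct.map (LinearMap.inr k A H) (LinearMap.inr k A H) ∘ₗ δH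
    + TensorProduct.map (LinearMap.inr k A H) (LinearMap.inl k A H) ∘ₗ ψ
    - TensorProduct.map (LinearMap.inl k A H) (LinearMap.inr k A H)
        ∘ₗ (TensorProduct.comm k H A).toLinearMap ∘ₗ ψ
    + TensorProduct.map (LinearMap.inl k A H) (LinearMap.inl k A H) ∘ₗ Q) ∘ₗ LinearMap.snd k A H

section helpers

/-- Value of the semidirect cobracket. -/
theorem aux_cob (δA : A →ₗ[k] A ⊗[k] A) (δH : H →ₗ[k] H ⊗[k] H)
    (φ : A →ₗ[k] H ⊗[k] A) (a : A) (h : H) :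
    bbCobracket δA δH φ 0 0 0 (a, h) =
      TensorProduct.map (LinearMap.inl k A H) (LinearMap.inl k A H) (δA a)
      + TensorProduct.map (LinearMap.inr k A H) (LinearMap.inl k A H) (φ a)
      - TensorProduct.map (LinearMap.inl k A H) (LinearMap.inr k A H)
          (TensorProduct.comm k H A (φ a))
      + TensorProduct.map (LinearMap.inr k A H) (LinearMap.inr k A H) (δH h) := by
  simp [bbCobracket]

theorem aux_br (brA : A →ₗ[k] A →ₗ[k] A) (brH : H →ₗ[k] H →ₗ[k] H)
    (l : H →ₗ[k] A →ₗ[k] H) (x y : A × H) :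
    bbBracket brA brH 0 l 0 0 x y =
      (brA x.1 y.1, brH x.2 y.2 + l x.2 y.1 - l y.2 x.1) := by
  simp [bbBracket]

variable {L M N P M' N' P' Q : Type*} [AddCommGroup L] [Module k L]
  [AddCommGroup M] [Module k M] [AddCommGroup N] [Module k N] [AddCommGroup P] [Module k P]
  [AddCommGroup M'] [Module k M'] [AddCommGroup N'] [Module k N']
  [AddCommGroup P'] [Module k P'] [AddCommGroup Q] [Module k Q]

theorem aux_mm (f : M →ₗ[k] M') (g : N →ₗ[k] N') (f' : P →ₗ[k] M) (g' : Q →ₗ[k] N)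
    (t : P ⊗[k] Q) : TensorProduct.map f g (TensorProduct.map f' g' t)
      = TensorProduct.map (f ∘ₗ f') (g ∘ₗ g') t := by
  rw [TensorProduct.map_comp]; rfl

theorem aux_comm (f : M →ₗ[k] M') (g : N →ₗ[k] N') (t : M ⊗[k] N) :
    TensorProduct.comm k M' N' (TensorProduct.map f g t)
      = TensorProduct.map g f (TensorProduct.comm k M N t) := by
  induction t with
  | zero => simp
  | tmul x y => simp
  | add x y hx hy => simp only [map_add, hx, hy]

theorem aux_sub_left (f f' : M →ₗ[k] M') (g : N →ₗ[k] N') (t : M ⊗[k] N) :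
    TensorProduct.map (f - f') g t = TensorProduct.map f g t - TensorProduct.map f' g t := by
  induction t with
  | zero => simp
  | tmul x y => simp [TensorProduct.sub_tmul]
  | add x y hx hy => simp only [map_add, hx, hy]; abel

theorem aux_sub_right (f : M →ₗ[k] M') (g g' : N →ₗ[k] N') (t : M ⊗[k] N) :
    TensorProduct.map f (g - g') t = TensorProduct.map f g t - TensorProduct.map f g' t := by
  induction t with
  | zero => simp
  | tmul x y => simp [TensorProduct.tmul_sub]
  | add x y hx hy => simp only [map_add, hx, hy]; abel

theorem aux_neg_left (f : M →ₗ[k] M') (g : N →ₗ[k] N') (t : M ⊗[k] N) :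
    TensorProduct.map (-f) g t = - TensorProduct.map f g t := by
  induction t with
  | zero => simp
  | tmul x y => simp [TensorProduct.neg_tmul]
  | add x y hx hy => simp only [map_add, hx, hy]; abel

theorem aux_neg_right (f : M →ₗ[k] M') (g : N →ₗ[k] N') (t : M ⊗[k] N) :
    TensorProduct.map f (-g) t = - TensorProduct.map f g t := by
  induction t with
  | zero => simp
  | tmul x y => simp [TensorProduct.tmul_neg]
  | add x y hx hy => simp only [map_add, hx, hy]; abel

theorem aux_xi_tmul (x y z : L) : ξmap k L ((x ⊗ₜ y) ⊗ₜ z) = (y ⊗ₜ z) ⊗ₜ x := by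
  simp [ξmap]

theorem aux_xi3 (t : (L ⊗[k] L) ⊗[k] L) : ξmap k L (ξmap k L (ξmap k L t)) = t := by
  induction t with
  | zero => simp
  | add x y hx hy => simp only [map_add, hx, hy]
  | tmul u z =>
    induction u with
    | zero => simp
    | add x y hx hy => simp only [map_add, TensorProduct.add_tmul, hx, hy]
    | tmul x y => simp only [aux_xi_tmul]

theorem aux_xi_nat (i : M →ₗ[k] L) (t : (M ⊗[k] M) ⊗[k] M) :
    ξmap k L (TensorProduct.map (TensorProduct.map i i) i t)
     = TensorProduct.map (TensorProduct.map i i) i (ξmap k M t) := by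
  induction t with
  | zero => simp
  | add x y hx hy => simp only [map_add, hx, hy]
  | tmul u z =>
    induction u with
    | zero => simp
    | add x y hx hy => simp only [map_add, TensorProduct.add_tmul, hx, hy]
    | tmul x y => simp only [aux_xi_tmul, TensorProduct.map_tmul]

/-- rotating `-(τ f(x)) ⊗ y`. -/
theorem aux_rot1 (i : M →ₗ[k] L) (j : N →ₗ[k] L) (f : M →ₗ[k] N ⊗[k] M) (t : M ⊗[k] M) :
    ξmap k L (TensorProduct.map (TensorProduct.map i j ∘ₗ (TensorProduct.comm k N M).toLinearMap ∘ₗ f) i t)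
    = TensorProduct.map (TensorProduct.map j i) i
        (TensorProduct.map (TensorProduct.comm k M N).toLinearMap LinearMap.id
          ((TensorProduct.assoc k M N M).symm
            (TensorProduct.map LinearMap.id f (TensorProduct.comm k M M t)))) := by
  induction t with
  | zero => simp
  | add x y hx hy => simp only [map_add, hx, hy]
  | tmul x y =>
    simp only [TensorProduct.map_tmul, TensorProduct.comm_tmul, LinearMap.comp_apply,
      LinearEquiv.coe_coe, LinearMap.id_apply]
    generalize f x = u
    induction u with
    | zero => simp
    | add x y hx hy => simp only [map_add, TensorProduct.add_tmul, TensorProduct.tmul_add, hx, hy]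
    | tmul p q => simp [aux_xi_tmul]

/-- rotating `g(x₀) ⊗ x₋₁` twice. -/
theorem aux_rot2 (i : M →ₗ[k] L) (j : N →ₗ[k] L) (i' : P →ₗ[k] L) (f : Q →ₗ[k] M ⊗[k] P)
    (t : N ⊗[k] Q) :
    ξmap k L (ξmap k L (TensorProduct.map (TensorProduct.map i i' ∘ₗ f) j
      (TensorProduct.comm k N Q t)))
    = TensorProduct.map (TensorProduct.map j i) i'
          ((TensorProduct.assoc k N M P).symm (TensorProduct.map LinearMap.id f t)) := by
  induction t with
  | zero => simp
  | add x y hx hy => simp only [map_add, hx, hy]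
  | tmul x y =>
    simp only [TensorProduct.map_tmul, TensorProduct.comm_tmul, LinearMap.comp_apply,
      LinearMap.id_apply]
    generalize f y = u
    induction u with
    | zero => simp
    | add x y hx hy => simp only [map_add, TensorProduct.add_tmul, TensorProduct.tmul_add, hx, hy]
    | tmul p q => simp [aux_xi_tmul]

/-- rotating `τ f(x₀) ⊗ x₋₁` once. -/
theorem aux_rot3 (i : M →ₗ[k] L) (j : N →ₗ[k] L) (f : M →ₗ[k] N ⊗[k] M) (t : N ⊗[k] M) :
    ξmap k L (TensorProduct.map (TensorProduct.map i j ∘ₗ (TensorProduct.comm k N M).toLinearMap ∘ₗ f) j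
      (TensorProduct.comm k N M t))
    = TensorProduct.map (TensorProduct.map j j) i
        (TensorProduct.map (TensorProduct.comm k N N).toLinearMap LinearMap.id
          ((TensorProduct.assoc k N N M).symm (TensorProduct.map LinearMap.id f t))) := by
  induction t with
  | zero => simp
  | add x y hx hy => simp only [map_add, hx, hy]
  | tmul x y =>
    simp only [TensorProduct.map_tmul, TensorProduct.comm_tmul, LinearMap.comp_apply,
      LinearEquiv.coe_coe, LinearMap.id_apply]
    generalize f y = u
    induction u with
    | zero => simp
    | add x y hx hy => simp only [map_add, TensorProduct.add_tmul, TensorProduct.tmul_add, hx, hy]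
    | tmul p q => simp [aux_xi_tmul]

/-- The linear bookkeeping of the co-Jacobi identity. -/
theorem aux_group {G : Type*} [AddCommGroup G]
    {j0 j1 j2 h0 h1 h2 p0 p1 p2 q0 q1 q2 d0 d1 d2 s0 s1 s2 u0 u1 u2 v0 v1 v2 w0 w1 w2 : G}
    (nA : j0 + j1 + j2 = 0) (nH : h0 + h1 + h2 = 0)
    (m1 : d0 = u2 - v1) (m1' : d1 = u0 - v2) (m1'' : d2 = u1 - v0)
    (m2 : s2 = p0 + w0) (m2' : s0 = p1 + w1) (m2'' : s1 = p2 + w2)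
    (r1 : q1 = -w0) (r1' : q2 = -w1) (r1'' : q0 = -w2) :
    (j0 + p0 - q0 + d0 - (s0 + u0 - v0) + h0) + (j1 + p1 - q1 + d1 - (s1 + u1 - v1) + h1)
      + (j2 + p2 - q2 + d2 - (s2 + u2 - v2) + h2) = 0 := by
  subst m1 m1' m1'' m2 m2' m2'' r1 r1' r1''
  have e : (j0 + j1 + j2) + (h0 + h1 + h2) = 0 := by rw [nA, nH, add_zero]
  rw [← e]
  abel

end helpers

set_option maxHeartbeats 2000000 in
/-- Given Lie bialgebras `A`, `H`, a right `A`-module Lie algebra structure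
`◁` on `H`, a left `H`-comodule Lie coalgebra structure `φ` on `A`, and conditions (BB6),
(BB7), (AA3), the right-left bicross product `A ⊳◀ H` (semidirect bracket, semidirect
cobracket) is a Lie bialgebra. -/
theorem bicross_product_is_lie_bialgebra [CharZero k]
    (brA : A →ₗ[k] A →ₗ[k] A) (δA : A →ₗ[k] A ⊗[k] A)
    (brH : H →ₗ[k] H →ₗ[k] H) (δH : H →ₗ[k] H ⊗[k] H)
    (l : H →ₗ[k] A →ₗ[k] H) (φ : A →ₗ[k] H ⊗[k] A)
    (hA : IsLieBialg brA δA) (hH : IsLieBialg brH δH)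
    -- `H` is a right `A`-module: `h ◁ [a,b] = (h◁a)◁b − (h◁b)◁a`
    (hmodH : ∀ h a b, l h (brA a b) = l (l h a) b - l (l h b) a)
    -- right `A`-module Lie algebra: `[h,g] ◁ a = [h◁a, g] + [h, g◁a]`
    (hmodbr : ∀ h g a, l (brH h g) a = brH (l h a) g + brH h (l g a))
    -- `A` is a left `H`-comodule
    (hcomodA : (∀ a, TensorProduct.map δH LinearMap.id (φ a)
        = (TensorProduct.assoc k H H A).symm (TensorProduct.map LinearMap.id φ (φ a))
        - TensorProduct.map (TensorProduct.comm k H H).toLinearMap LinearMap.id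
            ((TensorProduct.assoc k H H A).symm (TensorProduct.map LinearMap.id φ (φ a)))))
    -- left `H`-comodule Lie coalgebra:
    -- `a₍₋₁₎ ⊗ a₍₀₎₁ ⊗ a₍₀₎₂ = a₁₍₋₁₎ ⊗ a₁₍₀₎ ⊗ a₂ + a₂₍₋₁₎ ⊗ a₁ ⊗ a₂₍₀₎`
    (hcomodδ : ∀ a, (TensorProduct.assoc k H A A).symm (TensorProduct.map LinearMap.id δA (φ a))
        = TensorProduct.map φ LinearMap.id (δA a)
        + TensorProduct.map (TensorProduct.comm k A H).toLinearMap LinearMap.id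
            ((TensorProduct.assoc k A H A).symm (TensorProduct.map LinearMap.id φ (δA a))))
    -- (BB6) : `δ_H(h◁a) = h₁ ⊗ h₂◁a + h₁◁a ⊗ h₂ + a₍₋₁₎ ⊗ h◁a₍₀₎ − h◁a₍₀₎ ⊗ a₍₋₁₎`
    (hBB6 : ∀ h a, δH (l h a)
        = TensorProduct.map LinearMap.id (l.flip a) (δH h)
        + TensorProduct.map (l.flip a) LinearMap.id (δH h)
        + TensorProduct.map LinearMap.id (l h) (φ a)
        - TensorProduct.map (l h) LinearMap.id (TensorProduct.comm k H A (φ a)))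
    -- (BB7) : `φ([a,b]) = a₍₋₁₎ ⊗ [a₍₀₎,b] + b₍₋₁₎ ⊗ [a,b₍₀₎] + a₍₋₁₎◁b ⊗ a₍₀₎ − b₍₋₁₎◁a ⊗ b₍₀₎`
    (hBB7 : ∀ a b, φ (brA a b)
        = TensorProduct.map LinearMap.id (brA.flip b) (φ a)
        + TensorProduct.map LinearMap.id (brA a) (φ b)
        + TensorProduct.map (l.flip b) LinearMap.id (φ a)
        - TensorProduct.map (l.flip a) LinearMap.id (φ b))
    -- (AA3) : `[h, a₍₋₁₎] ⊗ a₍₀₎ + h◁a₁ ⊗ a₂ = 0` in `H ⊗ A`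
    (hAA3 : ∀ h a, TensorProduct.map (brH h) LinearMap.id (φ a)
        + TensorProduct.map (l h) LinearMap.id (δA a) = 0) :
    IsLieBialg (bbBracket brA brH 0 l 0 0) (bbCobracket δA δH φ 0 0 0) := by
  obtain ⟨⟨hA1, hA2⟩, ⟨hA3, hA4⟩, hA5⟩ := hA
  obtain ⟨⟨hH1, hH2⟩, ⟨hH3, hH4⟩, hH5⟩ := hH
  refine ⟨⟨?_, ?_⟩, ⟨?_, ?_⟩, ?_⟩
  · rintro ⟨a, h⟩ ⟨b, g⟩
    simp only [aux_br, Prod.neg_mk, Prod.mk.injEq]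
    refine ⟨hA1 a b, ?_⟩
    rw [hH1 h g]; abel
  · rintro ⟨a, h⟩ ⟨b, g⟩ ⟨c, f⟩
    simp only [aux_br, Prod.mk_add_mk, Prod.mk_eq_zero]
    refine ⟨hA2 a b c, ?_⟩
    have e := hH2 h g f
    simp only [map_add, map_sub, LinearMap.add_apply, LinearMap.sub_apply, hmodH, hmodbr]
    rw [hH1 (l h b) f, hH1 (l g c) h, hH1 (l f a) g, hH1 (l g a) f, hH1 (l h c) g, hH1 (l f b) h]
    rw [← e]
    abel
  · rintro ⟨a, h⟩
    simp only [aux_cob, map_add, map_sub, aux_comm, hA3, hH3, map_neg]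
    have : TensorProduct.comm k A H (TensorProduct.comm k H A (φ a)) = φ a := by
      rw [← TensorProduct.comm_symm]; exact LinearEquiv.symm_apply_apply _ _
    rw [this]; abel
  · rintro ⟨a, h⟩
    have c1 : bbCobracket δA δH φ 0 0 0 ∘ₗ LinearMap.inl k A H
        = TensorProduct.map (LinearMap.inl k A H) (LinearMap.inl k A H) ∘ₗ δA
        + TensorProduct.map (LinearMap.inr k A H) (LinearMap.inl k A H) ∘ₗ φ
        - TensorProduct.map (LinearMap.inl k A H) (LinearMap.inr k A H)
          ∘ₗ (TensorProduct.comm k H A).toLinearMap ∘ₗ φ := by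
      refine LinearMap.ext fun a => ?_
      simp [aux_cob]
    have c2 : bbCobracket δA δH φ 0 0 0 ∘ₗ LinearMap.inr k A H
        = TensorProduct.map (LinearMap.inr k A H) (LinearMap.inr k A H) ∘ₗ δH := by
      refine LinearMap.ext fun a => ?_
      simp [aux_cob]
    rw [aux_cob]
    simp only [map_add, map_sub, aux_mm, c1, c2, LinearMap.id_comp, TensorProduct.map_add_left,
      aux_sub_left, LinearMap.add_apply]
    have nA := congrArg (TensorProduct.map (TensorProduct.map (LinearMap.inl k A H)
      (LinearMap.inl k A H)) (LinearMap.inl k A H)) (hA4 a)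
    have nH := congrArg (TensorProduct.map (TensorProduct.map (LinearMap.inr k A H)
      (LinearMap.inr k A H)) (LinearMap.inr k A H)) (hH4 h)
    simp only [map_add, map_zero, ← aux_xi_nat, aux_mm, LinearMap.comp_id] at nA nH
    have r1 := aux_rot1 (LinearMap.inl k A H) (LinearMap.inr k A H) φ (δA a)
    have r2 := aux_rot2 (LinearMap.inl k A H) (LinearMap.inr k A H) (LinearMap.inl k A H) δA (φ a)
    have r3 := aux_rot2 (LinearMap.inr k A H) (LinearMap.inr k A H) (LinearMap.inl k A H) φ (φ a)
    have r4 := aux_rot3 (LinearMap.inl k A H) (LinearMap.inr k A H) φ (φ a)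
    have m1 := congrArg (TensorProduct.map (TensorProduct.map (LinearMap.inr k A H)
      (LinearMap.inr k A H)) (LinearMap.inl k A H)) (hcomodA a)
    have m2 := congrArg (TensorProduct.map (TensorProduct.map (LinearMap.inr k A H)
      (LinearMap.inl k A H)) (LinearMap.inl k A H)) (hcomodδ a)
    rw [hA3] at r1
    simp only [map_neg] at r1
    simp only [map_add, map_sub] at m1 m2
    rw [← r2, aux_mm] at m2
    rw [← r3, ← r4, aux_mm] at m1
    simp only [LinearMap.comp_id] at m1 m2
    have m1' := congrArg (ξmap k (A × H)) m1
    have m2' := congrArg (ξmap k (A × H)) m2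
    have m1'' := congrArg (ξmap k (A × H)) m1'
    have m2'' := congrArg (ξmap k (A × H)) m2'
    have r1' := congrArg (ξmap k (A × H)) r1
    have r1'' := congrArg (ξmap k (A × H)) r1'
    simp only [map_add, map_sub, map_neg, aux_xi3] at r1' r1'' m1' m2' m1'' m2''
    exact aux_group nA nH m1 m1' m1'' m2 m2' m2'' r1 r1' r1''
  · rintro ⟨a, h⟩ ⟨b, g⟩
    have b1 : ∀ (a : A) (h : H), bbBracket brA brH 0 l 0 0 (a, h) ∘ₗ LinearMap.inl k A H
        = LinearMap.inl k A H ∘ₗ brA a + LinearMap.inr k A H ∘ₗ l h := by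
      intro a h
      refine LinearMap.ext fun x => ?_
      simp [aux_br]
    have b2 : ∀ (a : A) (h : H), bbBracket brA brH 0 l 0 0 (a, h) ∘ₗ LinearMap.inr k A H
        = LinearMap.inr k A H ∘ₗ brH h - LinearMap.inr k A H ∘ₗ l.flip a := by
      intro a h
      refine LinearMap.ext fun x => ?_
      simp [aux_br]
    have b3 : (bbBracket brA brH 0 l 0 0).flip (b, g) = - bbBracket brA brH 0 l 0 0 (b, g) := by
      refine LinearMap.ext fun x => ?_
      simp only [LinearMap.flip_apply, LinearMap.neg_apply, aux_br, Prod.neg_mk, Prod.mk.injEq]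
      refine ⟨hA1 _ _, ?_⟩
      rw [hH1 x.2 g]; abel
    have f1 : ∀ b, brA.flip b = - brA b := fun b => LinearMap.ext fun x => by
      simpa using hA1 x b
    have f2 : ∀ b, brH.flip b = - brH b := fun b => LinearMap.ext fun x => by
      simpa using hH1 x b
    have cc : ∀ t : H ⊗[k] A, TensorProduct.comm k A H (TensorProduct.comm k H A t) = t := by
      intro t
      rw [← TensorProduct.comm_symm]; exact LinearEquiv.symm_apply_apply _ _
    have e1 := congrArg (TensorProduct.map (LinearMap.inl k A H) (LinearMap.inl k A H)) (hA5 a b)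
    have e2 := congrArg (TensorProduct.map (LinearMap.inr k A H) (LinearMap.inr k A H)) (hH5 h g)
    have e3 := congrArg (TensorProduct.map (LinearMap.inr k A H) (LinearMap.inl k A H)) (hBB7 a b)
    have e3' := congrArg (fun t => TensorProduct.map (LinearMap.inl k A H) (LinearMap.inr k A H)
      (TensorProduct.comm k H A t)) (hBB7 a b)
    have e4 := congrArg (TensorProduct.map (LinearMap.inr k A H) (LinearMap.inr k A H)) (hBB6 h b)
    have e5 := congrArg (TensorProduct.map (LinearMap.inr k A H) (LinearMap.inr k A H)) (hBB6 g a)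
    have e6 := congrArg (TensorProduct.map (LinearMap.inr k A H) (LinearMap.inl k A H)) (hAA3 h b)
    have e6' := congrArg (fun t => TensorProduct.map (LinearMap.inl k A H) (LinearMap.inr k A H)
      (TensorProduct.comm k H A t)) (hAA3 h b)
    have e7 := congrArg (TensorProduct.map (LinearMap.inr k A H) (LinearMap.inl k A H)) (hAA3 g a)
    have e7' := congrArg (fun t => TensorProduct.map (LinearMap.inl k A H) (LinearMap.inr k A H)
      (TensorProduct.comm k H A t)) (hAA3 g a)
    rw [b3, aux_br]
    simp only [aux_cob, map_add, map_sub, map_neg, map_zero, aux_comm, aux_mm, f1, f2, hA3, cc,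
      b1, b2, LinearMap.neg_comp, LinearMap.comp_neg, LinearMap.comp_id, LinearMap.id_comp,
      aux_neg_left, aux_neg_right, TensorProduct.map_add_left, TensorProduct.map_add_right,
      LinearMap.add_apply, aux_sub_left, aux_sub_right] at e1 e2 e3 e3' e4 e5 e6 e6' e7 e7' ⊢
    linear_combination (norm := module) e1 + e2 + e3 - e3' + e4 - e5 - e6 + e6' + e7 - e7'

end
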